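/- arXiv:0802.2751 — 10 statements merged into one kernel-verified Lean document; each statement's English description precedes it below -/
import Mathlib

section
/- Let θ be an irrational real number that is not a quadratic irrational, i.e., there is no triple of integers (A,B,C) ≠ (0,0,0) with A·θ² + B·θ + C = 0. If n is a positive integer and a, b, c, d are integers with a·d − b·c = 1 or a·d − b·c = −1 such that n·θ·(c·θ + d) = a·θ + b, then n = 1. -/
/-- If θ is irrational and not a quadratic irrational, and a determinant ±1 integer
matrix sends θ to n·θ with n a positive integer, then n = 1. -/
theorem stmt_0 (θ : ℝ) (hθ : Irrational θ)
    (hquad : ¬ ∃ A B C : ℤ, (A, B, C) ≠ (0, 0, 0) ∧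
      (A : ℝ) * θ ^ 2 + (B : ℝ) * θ + (C : ℝ) = 0)
    (n : ℕ) (hn : 0 < n) (a b c d : ℤ)
    (hdet : a * d - b * c = 1 ∨ a * d - b * c = -1)
    (heq : (n : ℝ) * θ * ((c : ℝ) * θ + (d : ℝ)) = (a : ℝ) * θ + (b : ℝ)) :
    n = 1 := by
  have hcoeff : ((n * c, n * d - a, -b) : ℤ × ℤ × ℤ) = (0, 0, 0) := by
    by_contra hne
    refine hquad ⟨n * c, n * d - a, -b, hne, ?_⟩
    push_cast
    linear_combination heq
  simp only [Prod.mk.injEq, neg_eq_zero, sub_eq_zero] at hcoeff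
  obtain ⟨-, rfl, rfl⟩ := hcoeff
  have hunit : IsUnit ((n : ℤ) * (d * d)) := by
    rw [Int.isUnit_iff]
    simpa [mul_assoc] using hdet
  exact Int.ofNat_isUnit.mp (isUnit_of_mul_isUnit_left hunit) |> Nat.isUnit_iff.mp
end

section
/- Let θ be an irrational real number satisfying k·θ² + l·θ + m = 0, where k is a positive integer and l, m are integers with gcd(k,l,m) = 1. Suppose n is a positive integer and a, b, c, d are integers with a·d − b·c = 1 or a·d − b·c = −1 such that n·θ·(c·θ + d) = a·θ + b. Then k·a = n·(k·d − l·c), k·b = −n·m·c, n·(k·d² − l·c·d + m·c²) = k or n·(k·d² − l·c·d + m·c²) = −k, and in particular n divides k. -/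
/-- An integer linear relation `p * x = q` for an irrational `x` is trivial. -/
theorem Irrational.eq_zero_and_eq_zero_of_intCast_mul_eq {x : ℝ} (hx : Irrational x) {p q : ℤ}
    (h : (p : ℝ) * x = q) : p = 0 ∧ q = 0 := by
  have hp : p = 0 := by
    by_contra hp
    exact (hx.intCast_mul hp).ne_int q h
  subst hp
  refine ⟨rfl, ?_⟩
  rw [Int.cast_zero, zero_mul] at h
  exact_mod_cast h.symm

/-- Lemma 2.5 (number-theoretic core): for a quadratic irrational θ with
kθ² + lθ + m = 0, gcd(k,l,m)=1, if a determinant ±1 integer matrix sends θ to nθ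
then ka = n(kd - lc), kb = -nmc, n(kd² - lcd + mc²) = ±k, and n divides k. -/
theorem stmt_1 (θ : ℝ) (hθ : Irrational θ) (k : ℤ) (hk : 0 < k) (l m : ℤ)
    (hgcd : Int.gcd k (Int.gcd l m) = 1)
    (hroot : (k : ℝ) * θ ^ 2 + (l : ℝ) * θ + (m : ℝ) = 0)
    (n : ℤ) (hn : 0 < n) (a b c d : ℤ)
    (hdet : a * d - b * c = 1 ∨ a * d - b * c = -1)
    (heq : (n : ℝ) * θ * ((c : ℝ) * θ + (d : ℝ)) = (a : ℝ) * θ + (b : ℝ)) :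
    k * a = n * (k * d - l * c) ∧ k * b = -(n * m * c) ∧
      (n * (k * d ^ 2 - l * c * d + m * c ^ 2) = k ∨
        n * (k * d ^ 2 - l * c * d + m * c ^ 2) = -k) ∧
      n ∣ k := by
  obtain ⟨h₁, h₂⟩ := hθ.eq_zero_and_eq_zero_of_intCast_mul_eq
    (p := k * (n * d - a) - n * c * l) (q := k * b + n * c * m) (by
      push_cast
      linear_combination (k : ℝ) * heq - (n : ℝ) * c * hroot)
  have h₃ : n * (k * d ^ 2 - l * c * d + m * c ^ 2) = k * (a * d - b * c) := by
    linear_combination d * h₁ + c * h₂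
  refine ⟨by linear_combination -h₁, by linear_combination h₂, ?_⟩
  rcases hdet with h | h <;> rw [h] at h₃
  · rw [mul_one] at h₃
    exact ⟨Or.inl h₃, Dvd.intro _ h₃⟩
  · rw [mul_neg_one] at h₃
    exact ⟨Or.inr h₃, (dvd_neg).mp (Dvd.intro _ h₃)⟩
end

section
/- Let θ be an irrational real number satisfying k·θ² + l·θ + m = 0, where k is a positive integer and l, m are integers with gcd(k,l,m) = 1. Let n be a positive divisor of k and write k = α·n with α a positive integer. Then there exist integers a, b, c, d with (a·d − b·c = 1 or a·d − b·c = −1) such that n·θ·(c·θ + d) = a·θ + b if and only if there exist integers x, y with n·x² − l·x·y + α·m·y² = 1 or n·x² − l·x·y + α·m·y² = −1. -/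
/-- An irrational number satisfies no nontrivial linear relation over the integers. -/
theorem Irrational.int_linear_eq_zero {θ : ℝ} (hθ : Irrational θ) {p q : ℤ}
    (h : (p : ℝ) * θ + q = 0) : p = 0 ∧ q = 0 := by
  have hp : p = 0 := by
    by_contra hp
    exact ((hθ.intCast_mul hp).add_intCast q).ne_zero h
  subst hp
  exact ⟨rfl, by simpa using h⟩

/-- An integer quadratic relation satisfied by an irrational root of a primitive integer
quadratic is an integer multiple of that quadratic. -/
theorem Irrational.exists_eq_mul_of_quadratic {θ : ℝ} (hθ : Irrational θ) {k l m : ℤ}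
    (hk : k ≠ 0) (hgcd : Int.gcd k (Int.gcd l m) = 1)
    (hroot : (k : ℝ) * θ ^ 2 + (l : ℝ) * θ + (m : ℝ) = 0) {p q r : ℤ}
    (h : (p : ℝ) * θ ^ 2 + (q : ℝ) * θ + (r : ℝ) = 0) :
    ∃ t : ℤ, p = k * t ∧ q = l * t ∧ r = m * t := by
  obtain ⟨hq, hr⟩ := hθ.int_linear_eq_zero (p := k * q - p * l) (q := k * r - p * m) (by
    push_cast
    linear_combination (k : ℝ) * h - (p : ℝ) * hroot)
  have hdvd : k ∣ (Int.gcd l m : ℤ) * p := by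
    rw [Int.gcd_eq_gcd_ab]
    exact ⟨q * Int.gcdA l m + r * Int.gcdB l m, by
      linear_combination -(Int.gcdA l m) * hq - Int.gcdB l m * hr⟩
  obtain ⟨t, rfl⟩ := (Int.isCoprime_iff_gcd_eq_one.mpr hgcd).dvd_of_dvd_mul_left hdvd
  refine ⟨t, rfl, mul_left_cancel₀ hk ?_, mul_left_cancel₀ hk ?_⟩
  · linear_combination hq
  · linear_combination hr


/-- Theorem 2.6 (number-theoretic content): for a quadratic irrational θ with
kθ² + lθ + m = 0, gcd(k,l,m)=1, and k = α·n, a determinant ±1 integer matrix sends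
θ to nθ iff the Diophantine equation nx² - lxy + αmy² = ±1 has an integer solution. -/
theorem stmt_2 (θ : ℝ) (hθ : Irrational θ) (k : ℤ) (hk : 0 < k) (l m : ℤ)
    (hgcd : Int.gcd k (Int.gcd l m) = 1)
    (hroot : (k : ℝ) * θ ^ 2 + (l : ℝ) * θ + (m : ℝ) = 0)
    (n α : ℤ) (hn : 0 < n) (hα : 0 < α) (hk' : k = α * n) :
    (∃ a b c d : ℤ, (a * d - b * c = 1 ∨ a * d - b * c = -1) ∧
        (n : ℝ) * θ * ((c : ℝ) * θ + (d : ℝ)) = (a : ℝ) * θ + (b : ℝ)) ↔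
      (∃ x y : ℤ, n * x ^ 2 - l * x * y + α * m * y ^ 2 = 1 ∨
        n * x ^ 2 - l * x * y + α * m * y ^ 2 = -1) := by
  constructor
  · rintro ⟨a, b, c, d, hdet, h⟩
    obtain ⟨t, hc, ha, hb⟩ := hθ.exists_eq_mul_of_quadratic hk.ne' hgcd hroot
      (p := n * c) (q := n * d - a) (r := -b) (by push_cast; linear_combination h)
    obtain rfl : c = α * t := mul_left_cancel₀ hn.ne' (by rw [hc, hk']; ring)
    have key : n * d ^ 2 - l * d * t + α * m * t ^ 2 = a * d - b * (α * t) := by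
      linear_combination d * ha - α * t * hb
    exact ⟨d, t, by rwa [key]⟩
  · rintro ⟨x, y, h⟩
    have key : (n * x - l * y) * x - (-(m * y)) * (α * y)
        = n * x ^ 2 - l * x * y + α * m * y ^ 2 := by ring
    refine ⟨n * x - l * y, -(m * y), α * y, x, by rwa [key], ?_⟩
    subst hk'
    push_cast at hroot ⊢
    linear_combination (y : ℝ) * hroot
end

section
/- Let p be a prime number and l, m integers with gcd(p,l,m) = 1. Let K be a number field of degree 2 over ℚ containing an element η with p·η² + l·η + m = 0 and η not in the image of ℚ in K. If there exist integers x, y with p·x² − l·x·y + m·y² = 1 or p·x² − l·x·y + m·y² = −1, then the ideal generated by p in the ring of integers 𝓞_K of K is not a prime ideal. -/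
open Polynomial in
/-- The coefficients of an integral quadratic equation satisfied by an algebraic integer of degree
at least two are divisible by the leading one. -/
theorem IsIntegral.dvd_of_quadratic {R : Type*} [CommRing R] [IsDomain R] [CharZero R]
    {x : R} (hx : IsIntegral ℤ x) (hirr : x ∉ (algebraMap ℤ R).range) {a b c : ℤ}
    (h : (a : R) * x ^ 2 + (b : R) * x + (c : R) = 0) : a ∣ b ∧ a ∣ c := by
  have hdeg : 2 ≤ (minpoly ℤ x).natDegree := (minpoly.two_le_natDegree_iff hx).2 hirr
  have hmonic := minpoly.monic hx
  obtain ⟨q, hq⟩ : minpoly ℤ x ∣ C a * X ^ 2 + C b * X + C c :=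
    minpoly.isIntegrallyClosed_dvd hx (by simpa using h)
  have hqdeg : q.natDegree = 0 := by
    by_cases hq0 : q = 0
    · simp [hq0]
    · have := natDegree_quadratic_le (a := a) (b := b) (c := c)
      rw [hq, hmonic.natDegree_mul' hq0] at this
      omega
  obtain ⟨d, rfl⟩ := natDegree_eq_zero.1 hqdeg
  have hcoeff (n : ℕ) : (C a * X ^ 2 + C b * X + C c).coeff n = (minpoly ℤ x).coeff n * d := by
    rw [hq, coeff_mul_C]
  have ha : a ∣ d := by
    by_cases hd : d = 0
    · simp [hd]
    · have hle := natDegree_quadratic_le (a := a) (b := b) (c := c)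
      rw [hq, natDegree_mul_C hd] at hle
      have htop := hcoeff 2
      have hlead : (minpoly ℤ x).coeff 2 = 1 := by
        rw [← le_antisymm hle hdeg]
        exact hmonic.coeff_natDegree
      rw [hlead, one_mul] at htop
      simp [-eq_intCast] at htop
      simp [htop]
  have hb := hcoeff 1
  have hc := hcoeff 0
  simp [coeff_X, coeff_C, -eq_intCast] at hb hc
  exact ⟨hb ▸ ha.mul_left _, hc ▸ ha.mul_left _⟩

/-- Corollary 2.12 (number-theoretic form): if pη² + lη + m = 0 with η generating a
real quadratic field K, gcd(p,l,m)=1, and px² - lxy + my² = ±1 has an integer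
solution, then p·𝓞_K is not a prime ideal. -/
theorem stmt_4 (p : ℕ) (hp : p.Prime) (l m : ℤ)
    (hgcd : Int.gcd (p : ℤ) (Int.gcd l m) = 1)
    (K : Type*) [Field K] [NumberField K] (hdeg : Module.finrank ℚ K = 2)
    (η : K) (hη : (p : K) * η ^ 2 + (l : K) * η + (m : K) = 0)
    (hirr : η ∉ Set.range (algebraMap ℚ K))
    (hsol : ∃ x y : ℤ, (p : ℤ) * x ^ 2 - l * x * y + m * y ^ 2 = 1 ∨
      (p : ℤ) * x ^ 2 - l * x * y + m * y ^ 2 = -1) :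
    ¬ (Ideal.span {(p : NumberField.RingOfIntegers K)}).IsPrime := by
  intro hprime
  have hp0 : (p : K) ≠ 0 := by exact_mod_cast hp.ne_zero
  have hnot (hl : (p : ℤ) ∣ l) (hm : (p : ℤ) ∣ m) : False := by
    have hdvd := Int.dvd_coe_gcd (dvd_refl (p : ℤ)) (Int.dvd_coe_gcd hl hm)
    rw [hgcd] at hdvd
    exact hp.one_lt.ne' (by exact_mod_cast Int.eq_one_of_dvd_one (by positivity) hdvd)
  have hint : IsIntegral ℤ ((p : K) * η) := by
    refine ⟨Polynomial.X ^ 2 + Polynomial.C l * Polynomial.X + Polynomial.C (p * m), ?_, ?_⟩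
    · monicity!
    · simp only [Polynomial.eval₂_add, Polynomial.eval₂_mul, Polynomial.eval₂_pow,
        Polynomial.eval₂_X, Polynomial.eval₂_C]
      push_cast [algebraMap_int_eq, eq_intCast]
      linear_combination (p : K) * hη
  obtain ⟨ω, hω⟩ : ∃ ω : NumberField.RingOfIntegers K, (ω : K) = p * η := ⟨⟨_, hint⟩, rfl⟩
  have hmem : ω * (ω + l) ∈ Ideal.span {(p : NumberField.RingOfIntegers K)} := by
    refine Ideal.mem_span_singleton.2 ⟨-m, ?_⟩
    apply NumberField.RingOfIntegers.ext
    simp [hω]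
    linear_combination (p : K) * hη
  rcases hprime.mem_or_mem hmem with h | h <;>
    obtain ⟨a, ha⟩ := Ideal.mem_span_singleton.1 h <;>
    have haK := congrArg (algebraMap (NumberField.RingOfIntegers K) K) ha <;>
    simp [hω] at haK
  · have hηa : η = a := haK.resolve_right hp.ne_zero
    have hdvd := IsIntegral.dvd_of_quadratic (hηa ▸ a.2 : IsIntegral ℤ η)
      (by rintro ⟨n, rfl⟩; exact hirr ⟨n, by simp⟩) (a := p) (by exact_mod_cast hη)
    exact hnot hdvd.1 hdvd.2
  · have hηa : η = a - l / p := by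
      field_simp
      linear_combination haK
    have hdvd := IsIntegral.dvd_of_quadratic (x := (a : K)) (a := p) (b := -l) (c := m) a.2
      (by rintro ⟨n, hn⟩; exact hirr ⟨n - l / p, by simp [hηa, ← hn]⟩) (by
        rw [hηa] at hη
        field_simp at hη
        push_cast
        refine mul_left_cancel₀ hp0 ?_
        linear_combination hη)
    exact hnot ((dvd_neg).1 hdvd.1) hdvd.2
end

section
/- For all integers x and y, 5·x² − 5·x·y − 2·y² ≠ 1 and 5·x² − 5·x·y − 2·y² ≠ −1. -/
/-- The squares modulo 5 are 0, 1 and 4. -/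
theorem Int.sq_emod_five (y : ℤ) : y ^ 2 % 5 = 0 ∨ y ^ 2 % 5 = 1 ∨ y ^ 2 % 5 = 4 := by
  have h : y % 5 = 0 ∨ y % 5 = 1 ∨ y % 5 = 2 ∨ y % 5 = 3 ∨ y % 5 = 4 := by omega
  rcases h with h | h | h | h | h <;> simp [pow_two, Int.mul_emod, h]

/-- Example 2.11: the equations 5x² - 5xy - 2y² = ±1 have no integer solutions. -/
theorem stmt_5 (x y : ℤ) :
    5 * x ^ 2 - 5 * x * y - 2 * y ^ 2 ≠ 1 ∧ 5 * x ^ 2 - 5 * x * y - 2 * y ^ 2 ≠ -1 := by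
  have hy := Int.sq_emod_five y
  rw [mul_assoc 5 x y]
  constructor <;> intro h <;> omega
end

section
/- Let K, c, d, a, b, m be integers with K ≥ 5, c ≠ 0, a·d − b·c = 1, and m·c = K·d − K + a. Let θ := (−K·(2d−1) + √(K²−4K))/(2·c·K). Then c·θ + d ≠ 0 and (a·θ + b)/(c·θ + d) = K·θ + m. -/
/-- Theorem 3.6 (1), computational core: for θ = (−K(2d−1) + √(K²−4K))/(2cK),
the fractional linear action of [[a,b],[c,d]] sends θ to Kθ + m. -/
theorem stmt_8 (K c d a b m : ℤ) (hK : 5 ≤ K) (hc : c ≠ 0)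
    (hdet : a * d - b * c = 1) (hm : m * c = K * d - K + a)
    (θ : ℝ)
    (hθ : θ = (-(K : ℝ) * (2 * (d : ℝ) - 1) + Real.sqrt ((K : ℝ) ^ 2 - 4 * K)) /
      (2 * (c : ℝ) * (K : ℝ))) :
    (c : ℝ) * θ + (d : ℝ) ≠ 0 ∧
      ((a : ℝ) * θ + (b : ℝ)) / ((c : ℝ) * θ + (d : ℝ)) = (K : ℝ) * θ + (m : ℝ) := by
  have hK' : (5 : ℝ) ≤ K := by exact_mod_cast hK
  have hc' : (c : ℝ) ≠ 0 := by exact_mod_cast hc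
  have hdet' : (a : ℝ) * d - b * c = 1 := by exact_mod_cast hdet
  have hm' : (m : ℝ) * c = K * d - K + a := by exact_mod_cast hm
  have hK0 : (K : ℝ) ≠ 0 := by positivity
  have hs : Real.sqrt ((K : ℝ) ^ 2 - 4 * K) ^ 2 = (K : ℝ) ^ 2 - 4 * K :=
    Real.sq_sqrt (by nlinarith)
  have hs0 := Real.sqrt_nonneg ((K : ℝ) ^ 2 - 4 * K)
  set s := Real.sqrt ((K : ℝ) ^ 2 - 4 * K)
  have hu : (c : ℝ) * θ + d = (K + s) / (2 * K) := by
    rw [hθ]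
    field_simp
    ring
  have hne : (c : ℝ) * θ + d ≠ 0 := by
    rw [hu]
    positivity
  have hquad : (K : ℝ) * (c * θ + d) ^ 2 - K * (c * θ + d) + 1 = 0 := by
    rw [hu]
    field_simp
    linear_combination hs
  refine ⟨hne, ?_⟩
  rw [div_eq_iff hne]
  apply mul_left_cancel₀ hc'
  linear_combination -hquad - hdet' - (c * θ + d) * hm'
end

section
/- Let K, c, d, a, b, m be integers with K ≥ 5, c ≠ 0, a·d − b·c = 1, and m·c = K·d − K + a. Let θ := (−K·(2d−1) − √(K²−4K))/(2·c·K). Then c·θ + d ≠ 0 and (a·θ + b)/(c·θ + d) = K·θ + m. -/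
/-- Theorem 3.6 (2), computational core: for θ = (−K(2d−1) − √(K²−4K))/(2cK),
the fractional linear action of [[a,b],[c,d]] sends θ to Kθ + m. -/
theorem stmt_9 (K c d a b m : ℤ) (hK : 5 ≤ K) (hc : c ≠ 0)
    (hdet : a * d - b * c = 1) (hm : m * c = K * d - K + a)
    (θ : ℝ)
    (hθ : θ = (-(K : ℝ) * (2 * (d : ℝ) - 1) - Real.sqrt ((K : ℝ) ^ 2 - 4 * K)) /
      (2 * (c : ℝ) * (K : ℝ))) :
    (c : ℝ) * θ + (d : ℝ) ≠ 0 ∧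
      ((a : ℝ) * θ + (b : ℝ)) / ((c : ℝ) * θ + (d : ℝ)) = (K : ℝ) * θ + (m : ℝ) := by
  have hKR : (5 : ℝ) ≤ K := by exact_mod_cast hK
  have hK0 : (K : ℝ) ≠ 0 := by positivity
  have hcR : (c : ℝ) ≠ 0 := by exact_mod_cast hc
  have hdetR : (a : ℝ) * d - b * c = 1 := by exact_mod_cast hdet
  have hmR : (m : ℝ) * c = K * d - K + a := by exact_mod_cast hm
  have hsq : Real.sqrt ((K : ℝ) ^ 2 - 4 * K) ^ 2 = (K : ℝ) ^ 2 - 4 * K :=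
    Real.sq_sqrt (by nlinarith)
  have hlin : Real.sqrt ((K : ℝ) ^ 2 - 4 * K) = K - 2 * K * (c * θ + d) := by
    rw [hθ]
    field_simp
    ring
  have hquad : (K : ℝ) * (c * θ + d) ^ 2 - K * (c * θ + d) + 1 = 0 := by
    rw [hlin] at hsq
    apply mul_left_cancel₀ (mul_ne_zero four_ne_zero hK0)
    linear_combination hsq
  have hden : (c : ℝ) * θ + d ≠ 0 := by
    intro h
    simp [h] at hquad
  refine ⟨hden, ?_⟩
  rw [div_eq_iff hden]
  apply mul_left_cancel₀ hcR
  linear_combination -hdetR - hquad - (c * θ + d) * hmR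
end

section
/- Let K, c, d, a, b, m be integers with K ≠ 0, c ≠ 0, a·d − b·c = 1, and m·c = K·d − K + a − 2. Let θ := (−K·(2d−1) + 2 − √(K²+4))/(2·c·K). Then c·θ + d ≠ 0 and (a·θ + b)/(c·θ + d) = K·θ + m. -/
/-- Theorem 3.6 (3), computational core: for θ = (−K(2d−1) + 2 − √(K²+4))/(2cK),
the fractional linear action of [[a,b],[c,d]] sends θ to Kθ + m. -/
theorem stmt_10 (K c d a b m : ℤ) (hK : K ≠ 0) (hc : c ≠ 0)
    (hdet : a * d - b * c = 1) (hm : m * c = K * d - K + a - 2)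
    (θ : ℝ)
    (hθ : θ = (-(K : ℝ) * (2 * (d : ℝ) - 1) + 2 - Real.sqrt ((K : ℝ) ^ 2 + 4)) /
      (2 * (c : ℝ) * (K : ℝ))) :
    (c : ℝ) * θ + (d : ℝ) ≠ 0 ∧
      ((a : ℝ) * θ + (b : ℝ)) / ((c : ℝ) * θ + (d : ℝ)) = (K : ℝ) * θ + (m : ℝ) := by
  have hK' : (K : ℝ) ≠ 0 := Int.cast_ne_zero.mpr hK
  have hc' : (c : ℝ) ≠ 0 := Int.cast_ne_zero.mpr hc
  have hdet' : (a : ℝ) * d - b * c = 1 := mod_cast hdet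
  have hm' : (m : ℝ) * c = K * d - K + a - 2 := mod_cast hm
  have hs : Real.sqrt ((K : ℝ) ^ 2 + 4) ^ 2 = (K : ℝ) ^ 2 + 4 := Real.sq_sqrt (by positivity)
  rw [eq_div_iff (by positivity)] at hθ
  set s := Real.sqrt ((K : ℝ) ^ 2 + 4)
  obtain ⟨u, hu⟩ : ∃ u, u = (c : ℝ) * θ + d := ⟨_, rfl⟩
  have hsu : s = K + 2 - 2 * K * u := by rw [hu]; linear_combination hθ
  have hquad : (K : ℝ) * u ^ 2 - (K + 2) * u + 1 = 0 := by
    rw [hsu] at hs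
    apply mul_left_cancel₀ (mul_ne_zero four_ne_zero hK')
    linear_combination hs
  rw [← hu]
  have hu0 : u ≠ 0 := by
    rintro rfl
    norm_num at hquad
  refine ⟨hu0, ?_⟩
  rw [div_eq_iff hu0]
  apply mul_left_cancel₀ hc'
  linear_combination (-a + K * u) * hu - hdet' - u * hm' - hquad
end

section
/- Let θ be an irrational real number and a, b, c, d, s, t integers with c ≠ 0, a·d − b·c = 1, s·(1−d) + t·c = 1, 0 < c·θ + d < 1, and (a·θ + b)·(1 − d − c·θ) = (s·θ + t)·(c·θ + d). Set K := s + a. Then c divides K·d² − K·d + 1, K ≥ 5, and θ = (−K·(2d−1) + √(K²−4K))/(2·c·K) or θ = (−K·(2d−1) − √(K²−4K))/(2·c·K). -/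
/-- Lemma 3.3, +1 case (number-theoretic core): if A_θ has a locally trivial
inclusion then θ lies in the set S₁. -/
theorem stmt_13 (θ : ℝ) (hθ : Irrational θ) (a b c d s t : ℤ) (hc : c ≠ 0)
    (hdet : a * d - b * c = 1) (hst : s * (1 - d) + t * c = 1)
    (htrace : 0 < (c : ℝ) * θ + (d : ℝ) ∧ (c : ℝ) * θ + (d : ℝ) < 1)
    (heq : ((a : ℝ) * θ + (b : ℝ)) * (1 - (d : ℝ) - (c : ℝ) * θ) =
      ((s : ℝ) * θ + (t : ℝ)) * ((c : ℝ) * θ + (d : ℝ)))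
    (K : ℤ) (hK : K = s + a) :
    c ∣ K * d ^ 2 - K * d + 1 ∧ 5 ≤ K ∧
      (θ = (-(K : ℝ) * (2 * (d : ℝ) - 1) + Real.sqrt ((K : ℝ) ^ 2 - 4 * K)) /
          (2 * (c : ℝ) * (K : ℝ)) ∨
        θ = (-(K : ℝ) * (2 * (d : ℝ) - 1) - Real.sqrt ((K : ℝ) ^ 2 - 4 * K)) /
          (2 * (c : ℝ) * (K : ℝ))) := by
  obtain ⟨hpos, hlt⟩ := htrace
  have hcR : (c : ℝ) ≠ 0 := Int.cast_ne_zero.mpr hc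
  have hdetR : (a : ℝ) * d - b * c = 1 := by exact_mod_cast hdet
  have hstR : (s : ℝ) * (1 - d) + t * c = 1 := by exact_mod_cast hst
  have hKR : (K : ℝ) = s + a := by exact_mod_cast hK
  have hirr : Irrational ((c : ℝ) * θ + d) := (hθ.intCast_mul hc).add_intCast d
  obtain ⟨x, hx⟩ : ∃ x : ℝ, x = c * θ + d := ⟨_, rfl⟩
  rw [← hx] at hpos hlt hirr
  have hquad : (K : ℝ) * (x * (1 - x)) = 1 := by
    rw [hKR, hx]
    linear_combination (c : ℝ) * heq + (1 - d - c * θ) * hdetR + (c * θ + d) * hstR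
  have hxpos : 0 < x * (1 - x) := mul_pos hpos (by linarith)
  have hhalf : x ≠ 1 / 2 := by
    intro h
    exact hirr ⟨1 / 2, by rw [h]; norm_num⟩
  have hquarter : x * (1 - x) < 1 / 4 := by
    have : 0 < (x - 1 / 2) ^ 2 := sq_pos_of_ne_zero (sub_ne_zero.mpr hhalf)
    nlinarith
  have hKpos : (0 : ℝ) < K := pos_of_mul_pos_left (by rw [hquad]; exact one_pos) hxpos.le
  have hK4 : (4 : ℝ) < K := by nlinarith
  refine ⟨⟨d * t + b * (d - 1), ?_⟩, ?_, ?_⟩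
  · rw [hK]
    linear_combination (d - 1) * hdet - d * hst
  · have : (4 : ℤ) < K := by exact_mod_cast hK4
    omega
  · have hsq : (2 * K * x - K) ^ 2 = Real.sqrt ((K : ℝ) ^ 2 - 4 * K) ^ 2 := by
      rw [Real.sq_sqrt (by nlinarith)]
      linear_combination -4 * (K : ℝ) * hquad
    have hden : 2 * (c : ℝ) * K ≠ 0 := mul_ne_zero (mul_ne_zero two_ne_zero hcR) hKpos.ne'
    refine (sq_eq_sq_iff_eq_or_eq_neg.mp hsq).imp (fun h => ?_) (fun h => ?_) <;>
    · rw [eq_div_iff hden]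
      linear_combination h - 2 * (K : ℝ) * hx
end

section
/- Let θ be an irrational real number and a, b, c, d, s, t integers with c ≠ 0, a·d − b·c = 1, s·(1−d) + t·c = −1, 0 < c·θ + d < 1, and (a·θ + b)·(1 − d − c·θ) = (s·θ + t)·(c·θ + d). Set K := s + a. Then K ≠ 0, c divides K·d² − K·d − 2·d + 1, and θ = (−K·(2d−1) + 2 − √(K²+4))/(2·c·K). -/
/-- Lemma 3.3, −1 case (number-theoretic core): if A_θ has a locally trivial
inclusion then θ lies in the set S₂. -/
theorem stmt_14 (θ : ℝ) (hθ : Irrational θ) (a b c d s t : ℤ) (hc : c ≠ 0)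
    (hdet : a * d - b * c = 1) (hst : s * (1 - d) + t * c = -1)
    (htrace : 0 < (c : ℝ) * θ + (d : ℝ) ∧ (c : ℝ) * θ + (d : ℝ) < 1)
    (heq : ((a : ℝ) * θ + (b : ℝ)) * (1 - (d : ℝ) - (c : ℝ) * θ) =
      ((s : ℝ) * θ + (t : ℝ)) * ((c : ℝ) * θ + (d : ℝ)))
    (K : ℤ) (hK : K = s + a) :
    K ≠ 0 ∧ c ∣ K * d ^ 2 - K * d - 2 * d + 1 ∧
      θ = (-(K : ℝ) * (2 * (d : ℝ) - 1) + 2 - Real.sqrt ((K : ℝ) ^ 2 + 4)) /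
        (2 * (c : ℝ) * (K : ℝ)) := by
  subst hK
  obtain ⟨hu0, hu1⟩ := htrace
  have hcR : (c : ℝ) ≠ 0 := Int.cast_ne_zero.mpr hc
  have hdetR : (a : ℝ) * d - b * c = 1 := by exact_mod_cast hdet
  have hstR : (s : ℝ) * (1 - d) + t * c = -1 := by exact_mod_cast hst
  obtain ⟨u, hu⟩ : ∃ u : ℝ, u = c * θ + d := ⟨_, rfl⟩
  rw [← hu] at hu0 hu1
  have hquad : ((s : ℝ) + a) * u * (1 - u) = 1 - 2 * u := by
    have h₁ : (c : ℝ) * (a * θ + b) = a * u - 1 := by rw [hu]; linear_combination -hdetR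
    have h₂ : (c : ℝ) * (s * θ + t) = s * (u - 1) - 1 := by rw [hu]; linear_combination hstR
    have h₃ : (1 : ℝ) - d - c * θ = 1 - u := by rw [hu]; ring
    rw [h₃, ← hu] at heq
    linear_combination c * heq - (1 - u) * h₁ + u * h₂
  have hK : s + a ≠ 0 := by
    intro h
    have hKR : (s : ℝ) + a = 0 := by exact_mod_cast h
    rw [hKR] at hquad
    refine hθ ⟨(1 - 2 * d) / (2 * c), ?_⟩
    push_cast
    rw [div_eq_iff (by positivity)]
    linear_combination 2 * hu - hquad
  have hKR : (s : ℝ) + a ≠ 0 := by exact_mod_cast hK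
  refine ⟨hK, ⟨d * t + (d - 1) * b, by linear_combination (d - 1) * hdet - d * hst⟩, ?_⟩
  have hnonneg : 0 ≤ ((s : ℝ) + a) * (1 - 2 * u) := by
    rw [← hquad, show ((s : ℝ) + a) * ((s + a) * u * (1 - u)) = (s + a) ^ 2 * (u * (1 - u)) by ring]
    exact mul_nonneg (sq_nonneg _) (mul_nonneg hu0.le (sub_nonneg.mpr hu1.le))
  have hsqrt : √(((s : ℝ) + a) ^ 2 + 4) = (s + a) * (1 - 2 * u) + 2 := by
    rw [show ((s : ℝ) + a) ^ 2 + 4 = ((s + a) * (1 - 2 * u) + 2) ^ 2 by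
      linear_combination 4 * ((s : ℝ) + a) * hquad]
    exact Real.sqrt_sq (by linarith)
  push_cast
  rw [hsqrt, eq_div_iff (by positivity), hu]
  ring
end
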